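/- arXiv:2205.11364 — 6 statements merged into one kernel-verified Lean document; each statement's English description precedes it below -/
import Mathlib

section
/- Let μ > 0, λ + μ > 0 and R > 0, and let E be the set of real numbers E = {2(λ+μ)/R} ∪ {4μ(λ+μ)/((λ+3μ)R)} ∪ {2μ(n−1)/R : n ∈ ℕ, n ≥ 2} ∪ {2(n+1)μ(λ+μ)/((λ+3μ)R) : n ∈ ℕ, n ≥ 2}. Then E has a least element; if λ > μ the least element of E equals 2μ/R, and if λ ≤ μ the least element of E equals 4μ(λ+μ)/((λ+3μ)R). -/
/-- The set of strictly positive Steklov–Lamé eigenvalues of the disk of radius `R`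
has a least element; it equals `2μ/R` when `λ > μ` and `4μ(λ+μ)/((λ+3μ)R)` when `λ ≤ μ`. -/
theorem steklov_lame_disk_first_eigenvalue (lam mu R : ℝ)
    (hmu : 0 < mu) (hlm : 0 < lam + mu) (hR : 0 < R)
    (E : Set ℝ)
    (hE : E = {x : ℝ | x = 2 * (lam + mu) / R} ∪
        {x : ℝ | x = 4 * mu * (lam + mu) / ((lam + 3 * mu) * R)} ∪
        {x : ℝ | ∃ n : ℕ, 2 ≤ n ∧ x = 2 * mu * ((n : ℝ) - 1) / R} ∪
        {x : ℝ | ∃ n : ℕ, 2 ≤ n ∧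
          x = 2 * ((n : ℝ) + 1) * mu * (lam + mu) / ((lam + 3 * mu) * R)}) :
    (∃ m : ℝ, IsLeast E m) ∧
    (mu < lam → IsLeast E (2 * mu / R)) ∧
    (lam ≤ mu → IsLeast E (4 * mu * (lam + mu) / ((lam + 3 * mu) * R))) := by
  have hd : 0 < lam + 3 * mu := by linarith
  have hfourth : ∀ n : ℕ, 2 ≤ n → 4 * mu * (lam + mu) / ((lam + 3 * mu) * R) ≤
      2 * ((n : ℝ) + 1) * mu * (lam + mu) / ((lam + 3 * mu) * R) := by
    intro n hn
    have hn' : (2 : ℝ) ≤ n := by exact_mod_cast hn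
    gcongr
    linarith
  have hthird : ∀ n : ℕ, 2 ≤ n → 2 * mu / R ≤ 2 * mu * ((n : ℝ) - 1) / R := by
    intro n hn
    have hn' : (2 : ℝ) ≤ n := by exact_mod_cast hn
    exact div_le_div_of_nonneg_right (by nlinarith) hR.le
  have hgt : mu < lam → IsLeast E (2 * mu / R) := by
    intro h
    have hle : 2 * mu / R ≤ 4 * mu * (lam + mu) / ((lam + 3 * mu) * R) := by
      rw [div_le_div_iff₀ hR (by positivity)]
      nlinarith [mul_pos (mul_pos hmu hR) (sub_pos.2 h)]
    subst hE
    refine ⟨Or.inl (Or.inr ⟨2, le_rfl, by norm_num⟩), ?_⟩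
    rintro x (((rfl | rfl) | ⟨n, hn, rfl⟩) | ⟨n, hn, rfl⟩)
    · gcongr
      linarith
    · exact hle
    · exact hthird n hn
    · exact hle.trans (hfourth n hn)
  have hle : lam ≤ mu → IsLeast E (4 * mu * (lam + mu) / ((lam + 3 * mu) * R)) := by
    intro h
    subst hE
    refine ⟨Or.inl (Or.inl (Or.inr rfl)), ?_⟩
    rintro x (((rfl | rfl) | ⟨n, hn, rfl⟩) | ⟨n, hn, rfl⟩)
    · rw [div_le_div_iff₀ (by positivity) hR]
      nlinarith [mul_pos (mul_pos hlm hR) hlm]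
    · exact le_rfl
    · refine le_trans ?_ (hthird n hn)
      rw [div_le_div_iff₀ (by positivity) hR]
      nlinarith [mul_nonneg (mul_pos hmu hR).le (sub_nonneg.2 h)]
    · exact hfourth n hn
  exact ⟨(lt_or_ge mu lam).elim (fun h => ⟨_, hgt h⟩) (fun h => ⟨_, hle h⟩), hgt, hle⟩
end

section
/- Let n ≥ 1 be an integer, R > 0, and λ, μ real numbers with λ + μ ≠ 0 and λ + 3μ ≠ 0. Let Nₙ be the 4×4 matrix with rows (−2μ(n−1)R^{n−2}, 0, −(2μ(n−2)(n+1)/n)Rⁿ, 0), (0, 2μ(n−1)R^{n−2}, 0, 2μ(n+1)Rⁿ), (0, 2μ(n−1)R^{n−2}, 0, (2μ(n−2)(n+1)/n)Rⁿ), (2μ(n−1)R^{n−2}, 0, 2μ(n+1)Rⁿ, 0), and let Pₙ be the 4×4 matrix with rows (−R^{n−1}, 0, −((μ(n−2)+λn)/(n(λ+μ)))R^{n+1}, 0), (0, R^{n−1}, 0, ((λ(n+2)+μ(n+4))/(n(λ+μ)))R^{n+1}), (0, R^{n−1}, 0, ((μ(n−2)+λn)/(n(λ+μ)))R^{n+1}),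 (R^{n−1}, 0, ((λ(n+2)+μ(n+4))/(n(λ+μ)))R^{n+1}, 0). Then for every real Λ, det(Λ·Pₙ − Nₙ) = −(4(λ+3μ)²R^{4n}/((λ+μ)²n²)) · (Λ − 2μ(n−1)/R)² · (Λ − 2(n+1)μ(λ+μ)/((λ+3μ)R))². In particular, the generalized eigenvalues Λ with det(Λ·Pₙ − Nₙ) = 0 are exactly 2μ(n−1)/R (with multiplicity two) and 2(n+1)μ(λ+μ)/((λ+3μ)R) (with multiplicity two). -/
open Matrix

/-- The matrix `Nₙ` arising from the Steklov–Lamé boundary condition on the disk of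
radius `R` for the `n`-th Fourier mode. -/
noncomputable def steklovLameN (n : ℕ) (R mu : ℝ) : Matrix (Fin 4) (Fin 4) ℝ :=
  !![-(2 * mu * ((n : ℝ) - 1) * R ^ ((n : ℤ) - 2)), 0,
      -(2 * mu * ((n : ℝ) - 2) * ((n : ℝ) + 1) / n) * R ^ (n : ℤ), 0;
     0, 2 * mu * ((n : ℝ) - 1) * R ^ ((n : ℤ) - 2), 0,
      2 * mu * ((n : ℝ) + 1) * R ^ (n : ℤ);
     0, 2 * mu * ((n : ℝ) - 1) * R ^ ((n : ℤ) - 2), 0,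
      (2 * mu * ((n : ℝ) - 2) * ((n : ℝ) + 1) / n) * R ^ (n : ℤ);
     2 * mu * ((n : ℝ) - 1) * R ^ ((n : ℤ) - 2), 0,
      2 * mu * ((n : ℝ) + 1) * R ^ (n : ℤ), 0]

/-- The matrix `Pₙ` arising from the Steklov–Lamé boundary condition on the disk of
radius `R` for the `n`-th Fourier mode. -/
noncomputable def steklovLameP (n : ℕ) (R lam mu : ℝ) : Matrix (Fin 4) (Fin 4) ℝ :=
  !![-R ^ ((n : ℤ) - 1), 0,
      -((mu * ((n : ℝ) - 2) + lam * n) / (n * (lam + mu))) * R ^ ((n : ℤ) + 1), 0;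
     0, R ^ ((n : ℤ) - 1), 0,
      ((lam * ((n : ℝ) + 2) + mu * ((n : ℝ) + 4)) / (n * (lam + mu))) * R ^ ((n : ℤ) + 1);
     0, R ^ ((n : ℤ) - 1), 0,
      ((mu * ((n : ℝ) - 2) + lam * n) / (n * (lam + mu))) * R ^ ((n : ℤ) + 1);
     R ^ ((n : ℤ) - 1), 0,
      ((lam * ((n : ℝ) + 2) + mu * ((n : ℝ) + 4)) / (n * (lam + mu))) * R ^ ((n : ℤ) + 1), 0]

/-- Determinant of a `4 × 4` matrix with the sparsity pattern of `Λ Pₙ − Nₙ`. -/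
theorem det_steklovLame_pattern {S : Type*} [CommRing S] (a b c : S) :
    !![-a, 0, -b, 0; 0, a, 0, c; 0, a, 0, b; a, 0, c, 0].det = -(a ^ 2 * (c - b) ^ 2) := by
  simp [Matrix.det_succ_row_zero, Fin.sum_univ_succ, Fin.succAbove]
  ring

/-- The pencil `Λ Pₙ − Nₙ` in terms of its three distinct entries up to sign. -/
theorem smul_steklovLameP_sub_steklovLameN (n : ℕ) (R lam mu Λ : ℝ) :
    ∃ a b c : ℝ,
      a = Λ * R ^ ((n : ℤ) - 1) - 2 * mu * ((n : ℝ) - 1) * R ^ ((n : ℤ) - 2) ∧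
      b = Λ * (((mu * ((n : ℝ) - 2) + lam * n) / (n * (lam + mu))) * R ^ ((n : ℤ) + 1)) -
        (2 * mu * ((n : ℝ) - 2) * ((n : ℝ) + 1) / n) * R ^ (n : ℤ) ∧
      c = Λ * (((lam * ((n : ℝ) + 2) + mu * ((n : ℝ) + 4)) / (n * (lam + mu))) *
        R ^ ((n : ℤ) + 1)) - 2 * mu * ((n : ℝ) + 1) * R ^ (n : ℤ) ∧
      Λ • steklovLameP n R lam mu - steklovLameN n R mu =
        !![-a, 0, -b, 0; 0, a, 0, c; 0, a, 0, b; a, 0, c, 0] := by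
  refine ⟨_, _, _, rfl, rfl, rfl, ?_⟩
  ext i j
  fin_cases i <;> fin_cases j <;> simp [steklovLameP, steklovLameN] <;> ring

/-- `det(Λ Pₙ − Nₙ)` factors as
`−(4(λ+3μ)²R^{4n}/((λ+μ)²n²)) (Λ − 2μ(n−1)/R)² (Λ − 2(n+1)μ(λ+μ)/((λ+3μ)R))²`,
so the generalized eigenvalues are exactly `2μ(n−1)/R` and `2(n+1)μ(λ+μ)/((λ+3μ)R)`,
each with multiplicity two. -/
theorem steklovLame_generalized_eigenvalues (n : ℕ) (hn : 1 ≤ n) (R lam mu : ℝ)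
    (hR : 0 < R) (hlm : lam + mu ≠ 0) (hl3m : lam + 3 * mu ≠ 0) :
    ∀ Λ : ℝ,
      (Λ • steklovLameP n R lam mu - steklovLameN n R mu).det =
        -(4 * (lam + 3 * mu) ^ 2 * R ^ (4 * (n : ℤ)) / ((lam + mu) ^ 2 * (n : ℝ) ^ 2)) *
          (Λ - 2 * mu * ((n : ℝ) - 1) / R) ^ 2 *
          (Λ - 2 * ((n : ℝ) + 1) * mu * (lam + mu) / ((lam + 3 * mu) * R)) ^ 2 ∧
      ((Λ • steklovLameP n R lam mu - steklovLameN n R mu).det = 0 ↔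
        Λ = 2 * mu * ((n : ℝ) - 1) / R ∨
        Λ = 2 * ((n : ℝ) + 1) * mu * (lam + mu) / ((lam + 3 * mu) * R)) := by
  have hn0 : (n : ℝ) ≠ 0 := Nat.cast_ne_zero.mpr (by omega)
  have hR0 : R ≠ 0 := hR.ne'
  intro Λ
  have hdet : (Λ • steklovLameP n R lam mu - steklovLameN n R mu).det =
      -(4 * (lam + 3 * mu) ^ 2 * R ^ (4 * (n : ℤ)) / ((lam + mu) ^ 2 * (n : ℝ) ^ 2)) *
        (Λ - 2 * mu * ((n : ℝ) - 1) / R) ^ 2 *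
        (Λ - 2 * ((n : ℝ) + 1) * mu * (lam + mu) / ((lam + 3 * mu) * R)) ^ 2 := by
    obtain ⟨a, b, c, ha, hb, hc, hM⟩ := smul_steklovLameP_sub_steklovLameN n R lam mu Λ
    have ha' : a = R ^ (n : ℤ) / R * (Λ - 2 * mu * ((n : ℝ) - 1) / R) := by
      rw [ha, zpow_sub₀ hR0, zpow_sub₀ hR0, zpow_one, zpow_ofNat]
      field_simp
    have hcb : c - b = 2 * (lam + 3 * mu) / (n * (lam + mu)) * (R ^ (n : ℤ) * R) *
        (Λ - 2 * ((n : ℝ) + 1) * mu * (lam + mu) / ((lam + 3 * mu) * R)) := by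
      rw [hb, hc, zpow_add_one₀ hR0]
      obtain ⟨s, hs⟩ : ∃ s, s = lam + 3 * mu := ⟨_, rfl⟩
      rw [← hs] at hl3m ⊢
      field_simp
      rw [hs]
      ring
    have hpow : R ^ (4 * (n : ℤ)) = (R ^ (n : ℤ)) ^ 4 := by
      rw [mul_comm, _root_.zpow_mul, zpow_ofNat]
    rw [hM, det_steklovLame_pattern, ha', hcb, hpow]
    generalize Λ - 2 * mu * ((n : ℝ) - 1) / R = x
    generalize Λ - 2 * ((n : ℝ) + 1) * mu * (lam + mu) / ((lam + 3 * mu) * R) = y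
    generalize R ^ (n : ℤ) = q
    field_simp
    ring
  refine ⟨hdet, ?_⟩
  have hcoef : -(4 * (lam + 3 * mu) ^ 2 * R ^ (4 * (n : ℤ)) /
      ((lam + mu) ^ 2 * (n : ℝ) ^ 2)) ≠ 0 := by
    have := zpow_ne_zero (4 * (n : ℤ)) hR0
    exact neg_ne_zero.mpr (by positivity)
  rw [hdet, mul_eq_zero, mul_eq_zero, or_iff_right hcoef, pow_eq_zero_iff two_ne_zero,
    pow_eq_zero_iff two_ne_zero, sub_eq_zero, sub_eq_zero]
end

section
/- Let n ≥ 1 be an integer, R > 0, and λ, μ real numbers with λ + μ ≠ 0 and λ + 3μ ≠ 0, and let Nₙ, Pₙ be the 4×4 matrices defined in the context. Then: (a) for v₃ = (−1, 0, 0, 0)ᵀ and v₄ = (0, 1, 0, 0)ᵀ one has Nₙ v₃ = (2μ(n−1)/R) Pₙ v₃ and Nₙ v₄ = (2μ(n−1)/R) Pₙ v₄; (b) for v₁ = (−(n+1)R²/n, 0, 1, 0)ᵀ and v₂ = (0, −(n+1)R²/n, 0, 1)ᵀ one has Nₙ v₁ = (2(n+1)μ(λ+μ)/((λ+3μ)R))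 Pₙ v₁ and Nₙ v₂ = (2(n+1)μ(λ+μ)/((λ+3μ)R)) Pₙ v₂. -/
open Matrix

/-- The explicit generalized eigenvectors of the pencil `(Nₙ, Pₙ)`:
`v₃, v₄` are associated to the eigenvalue `2μ(n−1)/R` and `v₁, v₂` to
`2(n+1)μ(λ+μ)/((λ+3μ)R)`. -/
theorem steklovLame_generalized_eigenvectors (n : ℕ) (hn : 1 ≤ n) (R lam mu : ℝ)
    (hR : 0 < R) (hlm : lam + mu ≠ 0) (hl3m : lam + 3 * mu ≠ 0) :
    (steklovLameN n R mu).mulVec ![-1, 0, 0, 0] =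
      (2 * mu * ((n : ℝ) - 1) / R) • (steklovLameP n R lam mu).mulVec ![-1, 0, 0, 0] ∧
    (steklovLameN n R mu).mulVec ![0, 1, 0, 0] =
      (2 * mu * ((n : ℝ) - 1) / R) • (steklovLameP n R lam mu).mulVec ![0, 1, 0, 0] ∧
    (steklovLameN n R mu).mulVec ![-((n : ℝ) + 1) * R ^ 2 / n, 0, 1, 0] =
      (2 * ((n : ℝ) + 1) * mu * (lam + mu) / ((lam + 3 * mu) * R)) •
        (steklovLameP n R lam mu).mulVec ![-((n : ℝ) + 1) * R ^ 2 / n, 0, 1, 0] ∧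
    (steklovLameN n R mu).mulVec ![0, -((n : ℝ) + 1) * R ^ 2 / n, 0, 1] =
      (2 * ((n : ℝ) + 1) * mu * (lam + mu) / ((lam + 3 * mu) * R)) •
        (steklovLameP n R lam mu).mulVec ![0, -((n : ℝ) + 1) * R ^ 2 / n, 0, 1] := by
  have hn0 : (n : ℝ) ≠ 0 := by positivity
  have hR0 : R ≠ 0 := hR.ne'
  have hl3m' : lam + mu * 3 ≠ 0 := by rwa [mul_comm mu]
  have hsub_one : R ^ ((n : ℤ) - 1) = R ^ n / R := by
    rw [zpow_sub_one₀ hR0, zpow_natCast, div_eq_mul_inv]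
  have hsub_two : R ^ ((n : ℤ) - 2) = R ^ n / R ^ 2 := by
    rw [zpow_sub₀ hR0, zpow_natCast, zpow_ofNat]
  have hadd_one : R ^ ((n : ℤ) + 1) = R ^ n * R := by
    rw [zpow_add_one₀ hR0, zpow_natCast]
  refine ⟨?_, ?_, ?_, ?_⟩ <;> ext i <;> fin_cases i <;>
    simp [steklovLameN, steklovLameP, Matrix.mulVec, dotProduct, Fin.sum_univ_four,
      hsub_one, hsub_two, hadd_one] <;>
    field_simp <;> ring
end

section
/- Let λ, μ, R be real numbers with R > 0, let m ≥ 1 be an integer, and define u, v : ℝ² → ℝ² by u(x₁,x₂) = (Re((x₁+ix₂)^m), −Im((x₁+ix₂)^m)) and v(x₁,x₂) = (Im((x₁+ix₂)^m), Re((x₁+ix₂)^m)). Then for each of w = u and w = v: the Jacobian Dw(x) is symmetric with zero trace at every x (so e(w) = Dw and tr(e(w)) = 0), div(Ae(w)) = 0 on ℝ², and for every x with |x| = R one has Ae(w)(x)·(x/R) = (2μm/R) w(x). In other words, (u, 2μm/R) and (v, 2μm/R) are Steklov–Lamé eigenpairs on the disk of radius R; with n = m+1 ≥ 2 this gives the eigenvalue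 2μ(n−1)/R of the disk. -/
open Matrix

/-- Jacobian matrix of a map `u : ℝ² → ℝ²`. -/
noncomputable def jacobian (u : (Fin 2 → ℝ) → Fin 2 → ℝ) (x : Fin 2 → ℝ) :
    Matrix (Fin 2) (Fin 2) ℝ :=
  Matrix.of fun i j => fderiv ℝ (fun y => u y i) x (Pi.single j 1)

/-- Symmetrized gradient `e(u) = (Du + Duᵀ)/2`. -/
noncomputable def symGrad (u : (Fin 2 → ℝ) → Fin 2 → ℝ) (x : Fin 2 → ℝ) :
    Matrix (Fin 2) (Fin 2) ℝ :=
  (2⁻¹ : ℝ) • (jacobian u x + (jacobian u x)ᵀ)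

/-- Stress tensor `Ae(u) = 2μ e(u) + λ tr(e(u)) I₂` (Hooke's law). -/
noncomputable def stress (lam mu : ℝ) (u : (Fin 2 → ℝ) → Fin 2 → ℝ) (x : Fin 2 → ℝ) :
    Matrix (Fin 2) (Fin 2) ℝ :=
  (2 * mu) • symGrad u x + (lam * (symGrad u x).trace) • (1 : Matrix (Fin 2) (Fin 2) ℝ)

/-- Row-wise divergence of a matrix field: `(div S)ᵢ = Σⱼ ∂ⱼ Sᵢⱼ`. -/
noncomputable def matDiv (S : (Fin 2 → ℝ) → Matrix (Fin 2) (Fin 2) ℝ) (x : Fin 2 → ℝ) :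
    Fin 2 → ℝ :=
  fun i => ∑ j, fderiv ℝ (fun y => S y i j) x (Pi.single j 1)

/-- The identification of `ℝ²` with `ℂ` as a continuous linear map. -/
noncomputable def planeToComplex : (Fin 2 → ℝ) →L[ℝ] ℂ :=
  (ContinuousLinearMap.proj (R := ℝ) (φ := fun _ : Fin 2 => ℝ) 0).smulRight (1 : ℂ) +
    (ContinuousLinearMap.proj (R := ℝ) (φ := fun _ : Fin 2 => ℝ) 1).smulRight Complex.I

lemma planeToComplex_apply (x : Fin 2 → ℝ) :
    planeToComplex x = (x 0 : ℂ) + (x 1 : ℂ) * Complex.I := by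
  simp [planeToComplex]

lemma planeToComplex_single_zero : planeToComplex (Pi.single 0 1) = 1 := by
  simp [planeToComplex_apply]

lemma planeToComplex_single_one : planeToComplex (Pi.single 1 1) = Complex.I := by
  simp [planeToComplex_apply]

lemma hasFDerivAt_const_mul_planeToComplex_pow (c : ℂ) (k : ℕ) (x : Fin 2 → ℝ) :
    HasFDerivAt (fun y => c * planeToComplex y ^ k)
      ((c * (k * planeToComplex x ^ (k - 1))) • planeToComplex) x := by
  have h : HasDerivAt (fun z : ℂ => c * z ^ k) (c * (k * planeToComplex x ^ (k - 1)))
      (planeToComplex x) := (hasDerivAt_pow k _).const_mul c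
  exact h.comp_hasFDerivAt x planeToComplex.hasFDerivAt

lemma fderiv_re_const_mul_planeToComplex_pow (c : ℂ) (k : ℕ) (x h : Fin 2 → ℝ) :
    fderiv ℝ (fun y => (c * planeToComplex y ^ k).re) x h =
      (c * (k * planeToComplex x ^ (k - 1)) * planeToComplex h).re := by
  have H := Complex.reCLM.hasFDerivAt.comp x (hasFDerivAt_const_mul_planeToComplex_pow c k x)
  exact congrArg (fun L => L h) H.fderiv

lemma fderiv_im_const_mul_planeToComplex_pow (c : ℂ) (k : ℕ) (x h : Fin 2 → ℝ) :
    fderiv ℝ (fun y => (c * planeToComplex y ^ k).im) x h =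
      (c * (k * planeToComplex x ^ (k - 1)) * planeToComplex h).im := by
  have H := Complex.imCLM.hasFDerivAt.comp x (hasFDerivAt_const_mul_planeToComplex_pow c k x)
  exact congrArg (fun L => L h) H.fderiv

/-- The vector field on `ℝ²` corresponding to the conjugate of `c zᵐ`. -/
noncomputable def conjMonomial (c : ℂ) (m : ℕ) (x : Fin 2 → ℝ) : Fin 2 → ℝ :=
  ![(c * planeToComplex x ^ m).re, -(c * planeToComplex x ^ m).im]

/-- The symmetric trace-free matrix whose first row is `(Re a, -Im a)`. -/
def conjMulMatrix (a : ℂ) : Matrix (Fin 2) (Fin 2) ℝ :=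
  !![a.re, -a.im; -a.im, -a.re]

lemma transpose_conjMulMatrix (a : ℂ) : (conjMulMatrix a)ᵀ = conjMulMatrix a := by
  ext i j
  fin_cases i <;> fin_cases j <;> rfl

lemma trace_conjMulMatrix (a : ℂ) : (conjMulMatrix a).trace = 0 := by
  simp [conjMulMatrix, Matrix.trace_fin_two]

lemma smul_conjMulMatrix (r : ℝ) (a : ℂ) : r • conjMulMatrix a = conjMulMatrix (r * a) := by
  ext i j
  fin_cases i <;> fin_cases j <;> simp [conjMulMatrix]

lemma conjMulMatrix_mulVec (a : ℂ) (x : Fin 2 → ℝ) :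
    (conjMulMatrix a).mulVec x = ![(a * planeToComplex x).re, -(a * planeToComplex x).im] := by
  ext i
  fin_cases i <;>
    simp [conjMulMatrix, Matrix.mulVec, dotProduct, Fin.sum_univ_two, planeToComplex_apply]
  all_goals ring

lemma jacobian_conjMonomial (c : ℂ) (m : ℕ) (x : Fin 2 → ℝ) :
    jacobian (conjMonomial c m) x =
      conjMulMatrix (c * (m * planeToComplex x ^ (m - 1))) := by
  ext i j
  fin_cases i
  · refine (fderiv_re_const_mul_planeToComplex_pow c m x _).trans ?_
    fin_cases j <;>
      simp only [Fin.zero_eta, Fin.mk_one, planeToComplex_single_zero,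
        planeToComplex_single_one, mul_one, Complex.mul_I_re] <;> rfl
  · change fderiv ℝ (fun y => -(c * planeToComplex y ^ m).im) x (Pi.single j 1) = _
    rw [fderiv_fun_neg, _root_.neg_apply, fderiv_im_const_mul_planeToComplex_pow]
    fin_cases j <;>
      simp only [Fin.zero_eta, Fin.mk_one, planeToComplex_single_zero,
        planeToComplex_single_one, mul_one, Complex.mul_I_im] <;> rfl

lemma symGrad_eq_jacobian {w : (Fin 2 → ℝ) → Fin 2 → ℝ} {x : Fin 2 → ℝ}
    (h : (jacobian w x)ᵀ = jacobian w x) : symGrad w x = jacobian w x := by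
  rw [symGrad, h, ← two_smul ℝ, smul_smul]
  norm_num

lemma symGrad_conjMonomial (c : ℂ) (m : ℕ) (x : Fin 2 → ℝ) :
    symGrad (conjMonomial c m) x = jacobian (conjMonomial c m) x :=
  symGrad_eq_jacobian (by rw [jacobian_conjMonomial, transpose_conjMulMatrix])

lemma stress_conjMonomial (lam mu : ℝ) (c : ℂ) (m : ℕ) (x : Fin 2 → ℝ) :
    stress lam mu (conjMonomial c m) x =
      conjMulMatrix ((2 * mu : ℝ) * c * m * planeToComplex x ^ (m - 1)) := by
  rw [stress, symGrad_conjMonomial, jacobian_conjMonomial, trace_conjMulMatrix, mul_zero,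
    zero_smul, add_zero, smul_conjMulMatrix]
  congr 1
  ring

lemma matDiv_conjMulMatrix_pow (c : ℂ) (k : ℕ) (x : Fin 2 → ℝ) :
    matDiv (fun y => conjMulMatrix (c * planeToComplex y ^ k)) x = 0 := by
  ext i
  fin_cases i <;>
    simp [matDiv, conjMulMatrix, Fin.sum_univ_two, fderiv_fun_neg,
      Complex.mul_I_re, Complex.mul_I_im, -Complex.mul_re, -Complex.mul_im,
      fderiv_re_const_mul_planeToComplex_pow, fderiv_im_const_mul_planeToComplex_pow,
      planeToComplex_single_zero, planeToComplex_single_one]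

lemma stress_conjMonomial_mulVec (lam mu R : ℝ) (c : ℂ) {m : ℕ} (hm : m ≠ 0)
    (x : Fin 2 → ℝ) :
    (stress lam mu (conjMonomial c m) x).mulVec (R⁻¹ • x) =
      (2 * mu * (m : ℝ) / R) • conjMonomial c m x := by
  have h : (2 * mu : ℝ) * c * m * planeToComplex x ^ (m - 1) * planeToComplex x =
      ((2 * mu * m : ℝ) : ℂ) * (c * planeToComplex x ^ m) := by
    rw [← pow_sub_one_mul hm (planeToComplex x)]
    push_cast
    ring
  rw [stress_conjMonomial, Matrix.mulVec_smul, conjMulMatrix_mulVec, h, Complex.re_ofReal_mul,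
    Complex.im_ofReal_mul]
  ext i
  fin_cases i <;> simp [conjMonomial, -Complex.mul_re, -Complex.mul_im] <;> ring

/-- For `m ≥ 1`, the maps `u = (Re(zᵐ), −Im(zᵐ))` and `v = (Im(zᵐ), Re(zᵐ))`
(`z = x₁ + ix₂`) have symmetric trace-free Jacobians, satisfy the Lamé equations
`div(Ae(w)) = 0`, and are Steklov–Lamé eigenfunctions on the disk of radius `R`
with eigenvalue `2μm/R`. -/
theorem steklov_lame_disk_eigenpair_holomorphic (lam mu R : ℝ) (hR : 0 < R)
    (m : ℕ) (hm : 1 ≤ m)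
    (u v : (Fin 2 → ℝ) → Fin 2 → ℝ)
    (hu : u = fun x => ![(((x 0 : ℂ) + (x 1 : ℂ) * Complex.I) ^ m).re,
                         -(((x 0 : ℂ) + (x 1 : ℂ) * Complex.I) ^ m).im])
    (hv : v = fun x => ![(((x 0 : ℂ) + (x 1 : ℂ) * Complex.I) ^ m).im,
                         (((x 0 : ℂ) + (x 1 : ℂ) * Complex.I) ^ m).re]) :
    ∀ w : (Fin 2 → ℝ) → Fin 2 → ℝ, (w = u ∨ w = v) →
      (∀ x, (jacobian w x)ᵀ = jacobian w x) ∧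
      (∀ x, (jacobian w x).trace = 0) ∧
      (∀ x, symGrad w x = jacobian w x) ∧
      (∀ x, matDiv (stress lam mu w) x = 0) ∧
      (∀ x : Fin 2 → ℝ, x 0 ^ 2 + x 1 ^ 2 = R ^ 2 →
        (stress lam mu w x).mulVec (R⁻¹ • x) = (2 * mu * (m : ℝ) / R) • w x) := by
  have hu' : u = conjMonomial 1 m := by
    ext x i
    fin_cases i <;> simp [hu, conjMonomial, planeToComplex_apply]
  have hv' : v = conjMonomial (-Complex.I) m := by
    ext x i
    fin_cases i <;> simp [hv, conjMonomial, planeToComplex_apply]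
  intro w hw
  obtain ⟨c, rfl⟩ : ∃ c, w = conjMonomial c m := by
    rcases hw with rfl | rfl
    exacts [⟨_, hu'⟩, ⟨_, hv'⟩]
  refine ⟨fun x => ?_, fun x => ?_, symGrad_conjMonomial c m, fun x => ?_,
    fun x _ => stress_conjMonomial_mulVec lam mu R c (by omega) x⟩
  · rw [jacobian_conjMonomial, transpose_conjMulMatrix]
  · rw [jacobian_conjMonomial, trace_conjMulMatrix]
  · rw [funext (stress_conjMonomial lam mu c m)]
    exact matDiv_conjMulMatrix_pow _ _ x
end

section
/- Let λ, μ, R be real numbers with μ > 0, λ + μ > 0 and R > 0 (so λ + 3μ > 0), and let n ≥ 1 be an integer. Define u : ℝ² → ℝ² by u(x) = ((n+1)/n)(R² − |x|²) · (Re(z^{n−1}), −Im(z^{n−1})) + ((λ+3μ)/((λ+μ)n)) · (Re(z^{n+1}), Im(z^{n+1})), where z = x₁ + i x₂. Then div(Ae(u)) = 0 on ℝ², and for every x with |x| = R one has Ae(u)(x)·(x/R) = (2(n+1)μ(λ+μ)/((λ+3μ)R)) u(x). In other words, (u, 2(n+1)μ(λ+μ)/((λ+3μ)R)) is a Steklov–Lamé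 eigenpair on the disk of radius R; for n = 1 this gives the eigenvalue 4μ(λ+μ)/((λ+3μ)R). -/
open Matrix

/-- Real part of `(x₁ + i x₂) ^ k` as a function on `ℝ²`. -/
noncomputable def rePow (k : ℕ) (x : Fin 2 → ℝ) : ℝ :=
  (((x 0 : ℂ) + (x 1 : ℂ) * Complex.I) ^ k).re

/-- Imaginary part of `(x₁ + i x₂) ^ k` as a function on `ℝ²`. -/
noncomputable def imPow (k : ℕ) (x : Fin 2 → ℝ) : ℝ :=
  (((x 0 : ℂ) + (x 1 : ℂ) * Complex.I) ^ k).im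

lemma rePow_succ (k : ℕ) (x : Fin 2 → ℝ) :
    rePow (k + 1) x = x 0 * rePow k x - x 1 * imPow k x := by
  simp [rePow, imPow, pow_succ]
  ring

lemma imPow_succ (k : ℕ) (x : Fin 2 → ℝ) :
    imPow (k + 1) x = x 0 * imPow k x + x 1 * rePow k x := by
  simp [rePow, imPow, pow_succ]
  ring

lemma natCast_mul_rePow (k : ℕ) (x : Fin 2 → ℝ) :
    k * rePow k x = x 0 * (k * rePow (k - 1) x) - x 1 * (k * imPow (k - 1) x) := by
  cases k with
  | zero => simp
  | succ k => rw [rePow_succ, Nat.add_sub_cancel]; ring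

lemma natCast_mul_imPow (k : ℕ) (x : Fin 2 → ℝ) :
    k * imPow k x = x 0 * (k * imPow (k - 1) x) + x 1 * (k * rePow (k - 1) x) := by
  cases k with
  | zero => simp
  | succ k => rw [imPow_succ, Nat.add_sub_cancel]; ring

lemma hasFDerivAt_complex_pow (k : ℕ) (x : Fin 2 → ℝ) :
    HasFDerivAt (fun y : Fin 2 → ℝ => ((y 0 : ℂ) + (y 1 : ℂ) * Complex.I) ^ k)
      ((k * ((x 0 : ℂ) + (x 1 : ℂ) * Complex.I) ^ (k - 1)) •
        (Complex.ofRealCLM.comp (ContinuousLinearMap.proj (R := ℝ) (φ := fun _ : Fin 2 => ℝ) 0) +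
          Complex.I •
            Complex.ofRealCLM.comp
              (ContinuousLinearMap.proj (R := ℝ) (φ := fun _ : Fin 2 => ℝ) 1))) x := by
  have h (i : Fin 2) := Complex.ofRealCLM.hasFDerivAt.comp x (hasFDerivAt_apply (𝕜 := ℝ) i x)
  have h' := ((h 0).add ((h 1).mul_const Complex.I)).pow k
  refine h'.congr_fderiv ?_
  ext v
  simp

lemma hasFDerivAt_rePow (k : ℕ) (x : Fin 2 → ℝ) :
    HasFDerivAt (rePow k)
      ((k * rePow (k - 1) x) • ContinuousLinearMap.proj (R := ℝ) (φ := fun _ : Fin 2 => ℝ) 0 -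
        (k * imPow (k - 1) x) • ContinuousLinearMap.proj (R := ℝ) (φ := fun _ : Fin 2 => ℝ) 1)
      x := by
  refine (Complex.reCLM.hasFDerivAt.comp x (hasFDerivAt_complex_pow k x)).congr_fderiv ?_
  ext v
  simp [rePow, imPow]
  ring

lemma hasFDerivAt_imPow (k : ℕ) (x : Fin 2 → ℝ) :
    HasFDerivAt (imPow k)
      ((k * imPow (k - 1) x) • ContinuousLinearMap.proj (R := ℝ) (φ := fun _ : Fin 2 => ℝ) 0 +
        (k * rePow (k - 1) x) • ContinuousLinearMap.proj (R := ℝ) (φ := fun _ : Fin 2 => ℝ) 1)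
      x := by
  refine (Complex.imCLM.hasFDerivAt.comp x (hasFDerivAt_complex_pow k x)).congr_fderiv ?_
  ext v
  simp [rePow, imPow]

@[fun_prop]
lemma differentiableAt_rePow (k : ℕ) (x : Fin 2 → ℝ) : DifferentiableAt ℝ (rePow k) x :=
  (hasFDerivAt_rePow k x).differentiableAt

@[fun_prop]
lemma differentiableAt_imPow (k : ℕ) (x : Fin 2 → ℝ) : DifferentiableAt ℝ (imPow k) x :=
  (hasFDerivAt_imPow k x).differentiableAt

lemma fderiv_coord (i : Fin 2) (x : Fin 2 → ℝ) :
    fderiv ℝ (fun y : Fin 2 → ℝ => y i) x =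
      ContinuousLinearMap.proj (R := ℝ) (φ := fun _ : Fin 2 => ℝ) i :=
  (hasFDerivAt_apply i x).fderiv

lemma jacobian_secondFamily (a b r : ℝ) (m : ℕ) (x : Fin 2 → ℝ) :
    jacobian (fun y => (a * (r - (y 0 ^ 2 + y 1 ^ 2))) • ![rePow m y, -imPow m y] +
      b • ![rePow (m + 2) y, imPow (m + 2) y]) x =
    !![a * ((r - (x 0 ^ 2 + x 1 ^ 2)) * (m * rePow (m - 1) x) - 2 * x 0 * rePow m x) +
        b * ((m + 2) * rePow (m + 1) x),
      -a * ((r - (x 0 ^ 2 + x 1 ^ 2)) * (m * imPow (m - 1) x) + 2 * x 1 * rePow m x) -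
        b * ((m + 2) * imPow (m + 1) x);
      -a * ((r - (x 0 ^ 2 + x 1 ^ 2)) * (m * imPow (m - 1) x) - 2 * x 0 * imPow m x) +
        b * ((m + 2) * imPow (m + 1) x),
      -a * ((r - (x 0 ^ 2 + x 1 ^ 2)) * (m * rePow (m - 1) x) - 2 * x 1 * imPow m x) +
        b * ((m + 2) * rePow (m + 1) x)] := by
  ext i j
  fin_cases i <;> fin_cases j <;>
  · simp (disch := fun_prop) [jacobian, fderiv_fun_add, fderiv_fun_sub, fderiv_fun_mul,
      fderiv_fun_neg, fderiv_fun_pow, fderiv_coord, (hasFDerivAt_rePow _ _).fderiv,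
      (hasFDerivAt_imPow _ _).fderiv, Pi.single_apply]
    ring

lemma stress_secondFamily (lam mu a b r : ℝ) (m : ℕ) (x : Fin 2 → ℝ) :
    stress lam mu (fun y => (a * (r - (y 0 ^ 2 + y 1 ^ 2))) • ![rePow m y, -imPow m y] +
      b • ![rePow (m + 2) y, imPow (m + 2) y]) x =
    !![2 * mu * (a * ((r - (x 0 ^ 2 + x 1 ^ 2)) * (m * rePow (m - 1) x) - 2 * x 0 * rePow m x) +
          b * ((m + 2) * rePow (m + 1) x)) +
        2 * lam * (b * (m + 2) - a) * rePow (m + 1) x,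
      mu * (-2 * a * ((r - (x 0 ^ 2 + x 1 ^ 2)) * (m * imPow (m - 1) x) +
        (x 1 * rePow m x - x 0 * imPow m x)));
      mu * (-2 * a * ((r - (x 0 ^ 2 + x 1 ^ 2)) * (m * imPow (m - 1) x) +
        (x 1 * rePow m x - x 0 * imPow m x))),
      2 * mu * (-a * ((r - (x 0 ^ 2 + x 1 ^ 2)) * (m * rePow (m - 1) x) - 2 * x 1 * imPow m x) +
          b * ((m + 2) * rePow (m + 1) x)) +
        2 * lam * (b * (m + 2) - a) * rePow (m + 1) x] := by
  simp only [stress, symGrad, jacobian_secondFamily]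
  ext i j
  fin_cases i <;> fin_cases j <;>
  · simp [Matrix.trace, Fin.sum_univ_two, rePow_succ m]
    ring

lemma matDiv_stress_secondFamily (lam mu a b r : ℝ) (m : ℕ)
    (h : (lam + mu) * (b * (m + 2) - a) = 2 * mu * a) (x : Fin 2 → ℝ) :
    matDiv (stress lam mu (fun y => (a * (r - (y 0 ^ 2 + y 1 ^ 2))) • ![rePow m y, -imPow m y] +
      b • ![rePow (m + 2) y, imPow (m + 2) y])) x = 0 := by
  have hre := natCast_mul_rePow m x
  have him := natCast_mul_imPow m x
  ext i
  simp only [matDiv, stress_secondFamily]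
  fin_cases i
  all_goals
    simp (disch := fun_prop) [Fin.sum_univ_two,
      fderiv_fun_add, fderiv_fun_sub, fderiv_fun_mul,
      fderiv_fun_neg, fderiv_fun_pow, fderiv_coord, (hasFDerivAt_rePow _ _).fderiv,
      (hasFDerivAt_imPow _ _).fderiv, Pi.single_apply]
  · linear_combination 2 * (m + 1) * rePow m x * h + 6 * mu * a * hre
  · linear_combination -2 * (m + 1) * imPow m x * h - 6 * mu * a * him

/-- For `n ≥ 1`, the map
`u(x) = ((n+1)/n)(R² − |x|²)(Re z^{n−1}, −Im z^{n−1}) + ((λ+3μ)/((λ+μ)n))(Re z^{n+1}, Im z^{n+1})`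
(`z = x₁ + ix₂`) satisfies `div(Ae(u)) = 0` and is a Steklov–Lamé eigenfunction on the
disk of radius `R` with eigenvalue `2(n+1)μ(λ+μ)/((λ+3μ)R)`. -/
theorem steklov_lame_disk_eigenpair_second_family (lam mu R : ℝ)
    (hmu : 0 < mu) (hlm : 0 < lam + mu) (hR : 0 < R)
    (n : ℕ) (hn : 1 ≤ n)
    (u : (Fin 2 → ℝ) → Fin 2 → ℝ)
    (hu : u = fun x =>
      (((n : ℝ) + 1) / n * (R ^ 2 - (x 0 ^ 2 + x 1 ^ 2))) •
        ![(((x 0 : ℂ) + (x 1 : ℂ) * Complex.I) ^ (n - 1)).re,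
          -(((x 0 : ℂ) + (x 1 : ℂ) * Complex.I) ^ (n - 1)).im] +
      ((lam + 3 * mu) / ((lam + mu) * n)) •
        ![(((x 0 : ℂ) + (x 1 : ℂ) * Complex.I) ^ (n + 1)).re,
          (((x 0 : ℂ) + (x 1 : ℂ) * Complex.I) ^ (n + 1)).im]) :
    (∀ x, matDiv (stress lam mu u) x = 0) ∧
    (∀ x : Fin 2 → ℝ, x 0 ^ 2 + x 1 ^ 2 = R ^ 2 →
      (stress lam mu u x).mulVec (R⁻¹ • x) =
        (2 * ((n : ℝ) + 1) * mu * (lam + mu) / ((lam + 3 * mu) * R)) • u x) := by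
  obtain ⟨m, rfl⟩ : ∃ m, n = m + 1 := ⟨n - 1, by omega⟩
  have hlm' : lam + mu ≠ 0 := hlm.ne'
  have hl3 : lam + 3 * mu ≠ 0 := by linarith
  set a : ℝ := (((m + 1 : ℕ) : ℝ) + 1) / (m + 1 : ℕ) with ha
  set b : ℝ := (lam + 3 * mu) / ((lam + mu) * (m + 1 : ℕ)) with hb
  have hu' : u = fun y => (a * (R ^ 2 - (y 0 ^ 2 + y 1 ^ 2))) • ![rePow m y, -imPow m y] +
      b • ![rePow (m + 2) y, imPow (m + 2) y] := hu
  have hba : b * (lam + mu) * (m + 2) = a * (lam + 3 * mu) := by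
    rw [ha, hb]
    push_cast
    field_simp
    ring
  clear_value a b
  have hk : 2 * ((m : ℝ) + 1 + 1) * mu * (lam + mu) / ((lam + 3 * mu) * R) * b =
      2 * mu * a * R⁻¹ := by
    rw [div_mul_eq_mul_div, div_eq_iff (mul_ne_zero hl3 hR.ne')]
    linear_combination 2 * mu * hba - 2 * mu * a * (lam + 3 * mu) * inv_mul_cancel₀ hR.ne'
  subst hu'
  refine ⟨matDiv_stress_secondFamily lam mu a b (R ^ 2) m (by linear_combination hba), ?_⟩
  intro x hx
  rw [stress_secondFamily]
  ext i
  fin_cases i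
  · simp [Matrix.mulVec, dotProduct, Fin.sum_univ_two, hx]
    rw [← mul_assoc _ b, hk, rePow_succ (m + 1), rePow_succ m, imPow_succ m]
    linear_combination 2 * R⁻¹ * x 0 * (x 0 * rePow m x - x 1 * imPow m x) * hba
  · simp [Matrix.mulVec, dotProduct, Fin.sum_univ_two, hx]
    rw [← mul_assoc _ b, hk, imPow_succ (m + 1), rePow_succ m, imPow_succ m]
    linear_combination 2 * R⁻¹ * x 1 * (x 0 * rePow m x - x 1 * imPow m x) * hba
end

section
/- Let λ, μ, R be real numbers with λ + μ ≠ 0 and set k = (λ+3μ)/(λ+μ). Define u₁, u₂ : ℝ² → ℝ² by u₁(x₁,x₂) = (2(R² − x₁² − x₂²) + k(x₁² − x₂²), 2k x₁x₂) and u₂(x₁,x₂) = (2k x₁x₂, 2(R² − x₁² − x₂²) − k(x₁² − x₂²)). Then for every x = (x₁,x₂) ∈ ℝ², writing r² = x₁² + x₂², one has Ae(u₁)(x):e(u₁)(x) + Ae(u₂)(x):e(u₂)(x) = 32 μ k r², i.e. = 32 μ ((λ+3μ)/(λ+μ)) r². -/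
open Matrix

/-- Frobenius inner product `S:T = Σᵢⱼ sᵢⱼ tᵢⱼ` of 2×2 matrices. -/
def frob (S T : Matrix (Fin 2) (Fin 2) ℝ) : ℝ := ∑ i, ∑ j, S i j * T i j

/-- The Jacobian of a map whose components are quadratic polynomials of the form
`c + a x₀² + b x₁² + d x₀ x₁`. -/
theorem jacobian_quadratic (c a b d : Fin 2 → ℝ) (x : Fin 2 → ℝ) :
    jacobian (fun y i => c i + a i * y 0 ^ 2 + b i * y 1 ^ 2 + d i * (y 0 * y 1)) x =
      Matrix.of fun i => ![2 * a i * x 0 + d i * x 1, 2 * b i * x 1 + d i * x 0] := by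
  have h0 : HasFDerivAt (fun y : Fin 2 → ℝ => y 0)
      (ContinuousLinearMap.proj (R := ℝ) (φ := fun _ : Fin 2 => ℝ) 0) x := hasFDerivAt_apply 0 x
  have h1 : HasFDerivAt (fun y : Fin 2 → ℝ => y 1)
      (ContinuousLinearMap.proj (R := ℝ) (φ := fun _ : Fin 2 => ℝ) 1) x := hasFDerivAt_apply 1 x
  ext i j
  have h := ((((h0.pow 2).const_mul (a i)).const_add (c i)).add
    ((h1.pow 2).const_mul (b i))).add ((h0.mul h1).const_mul (d i))
  change fderiv ℝ (fun y : Fin 2 → ℝ =>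
    c i + a i * y 0 ^ 2 + b i * y 1 ^ 2 + d i * (y 0 * y 1)) x (Pi.single j 1) = _
  rw [show fderiv ℝ (fun y : Fin 2 → ℝ =>
    c i + a i * y 0 ^ 2 + b i * y 1 ^ 2 + d i * (y 0 * y 1)) x = _ from h.fderiv]
  fin_cases j <;> simp <;> ring

/-- For the eigenfunctions `u₁, u₂` associated to the first non-zero Steklov–Lamé
eigenvalue of the disk of radius `R` (case `λ ≤ μ`), with `k = (λ+3μ)/(λ+μ)`, the total
elastic energy density is `Ae(u₁):e(u₁) + Ae(u₂):e(u₂) = 32μk r²` with `r² = x₁² + x₂²`. -/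
theorem steklov_lame_disk_eigenfunctions_energy (lam mu R : ℝ) (hlm : lam + mu ≠ 0)
    (k : ℝ) (hk : k = (lam + 3 * mu) / (lam + mu))
    (u₁ u₂ : (Fin 2 → ℝ) → Fin 2 → ℝ)
    (hu₁ : u₁ = fun x => ![2 * (R ^ 2 - x 0 ^ 2 - x 1 ^ 2) + k * (x 0 ^ 2 - x 1 ^ 2),
                          2 * k * x 0 * x 1])
    (hu₂ : u₂ = fun x => ![2 * k * x 0 * x 1,
                          2 * (R ^ 2 - x 0 ^ 2 - x 1 ^ 2) - k * (x 0 ^ 2 - x 1 ^ 2)]) :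
    ∀ x : Fin 2 → ℝ,
      frob (stress lam mu u₁ x) (symGrad u₁ x) + frob (stress lam mu u₂ x) (symGrad u₂ x) =
        32 * mu * ((lam + 3 * mu) / (lam + mu)) * (x 0 ^ 2 + x 1 ^ 2) := by
  intro x
  have hj₁ : jacobian u₁ x =
      !![(2 * k - 4) * x 0, -(2 * k + 4) * x 1; 2 * k * x 1, 2 * k * x 0] := by
    have hu : u₁ = fun y i => ![2 * R ^ 2, 0] i + ![k - 2, 0] i * y 0 ^ 2 +
        ![-(k + 2), 0] i * y 1 ^ 2 + ![0, 2 * k] i * (y 0 * y 1) := by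
      rw [hu₁]
      ext y i
      fin_cases i <;> simp <;> ring
    rw [hu, jacobian_quadratic]
    ext i j
    fin_cases i <;> fin_cases j <;> simp [-mul_eq_mul_right_iff] <;> ring
  have hj₂ : jacobian u₂ x =
      !![2 * k * x 1, 2 * k * x 0; -(2 * k + 4) * x 0, (2 * k - 4) * x 1] := by
    have hu : u₂ = fun y i => ![0, 2 * R ^ 2] i + ![0, -(k + 2)] i * y 0 ^ 2 +
        ![0, k - 2] i * y 1 ^ 2 + ![2 * k, 0] i * (y 0 * y 1) := by
      rw [hu₂]
      ext y i
      fin_cases i <;> simp <;> ring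
    rw [hu, jacobian_quadratic]
    ext i j
    fin_cases i <;> fin_cases j <;> simp [-mul_eq_mul_right_iff] <;> ring
  have hk' : (lam + mu) * (k - 1) = 2 * mu := by
    rw [hk]
    field_simp
    ring
  rw [← hk]
  simp only [frob, stress, symGrad, hj₁, hj₂, Matrix.trace, Matrix.diag, Fin.sum_univ_two]
  simp
  linear_combination 16 * (k - 1) * (x 0 ^ 2 + x 1 ^ 2) * hk'
end
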